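/- arXiv:2411.08004 — 4 statements merged into one kernel-verified Lean document; each statement's English description precedes it below -/
import Mathlib

section
/- Let R be a semiprime ring with (left Gabriel–Rentschler) Krull dimension and let σ be a ring endomorphism of R with large image. Then σ is injective. -/
/-- A two-sided ideal `I` of a ring is nilpotent if for some `n ≥ 1` every product of
`n` elements of `I` vanishes. -/
def TwoSidedIdeal.IsNilpotentIdeal {R : Type*} [Ring R] (I : TwoSidedIdeal R) : Prop :=
  ∃ n : ℕ, 0 < n ∧ ∀ f : Fin n → R, (∀ i, f i ∈ I) → (List.ofFn f).prod = 0

/-- A ring is semiprime if it has no nonzero nilpotent two-sided ideal. -/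
def IsSemiprimeRing' (R : Type*) [Ring R] : Prop :=
  ∀ I : TwoSidedIdeal R, I.IsNilpotentIdeal → I = ⊥

/-- A ring has finite left uniform dimension if it contains no infinite direct sum of
nonzero left ideals. -/
def HasFiniteLeftUniformDimension (R : Type*) [Ring R] : Prop :=
  ¬ ∃ f : ℕ → Ideal R, (∀ n, f n ≠ ⊥) ∧ iSupIndep f

/-- The left annihilator of a subset `S` of a ring. -/
def leftAnnihilator (R : Type*) [Ring R] (S : Set R) : Set R :=
  {r : R | ∀ s ∈ S, r * s = 0}

/-- The ascending chain condition on left annihilators. -/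
def ACCLeftAnnihilators (R : Type*) [Ring R] : Prop :=
  ∀ f : ℕ → Set R, (∀ n, ∃ S : Set R, f n = leftAnnihilator R S) → Monotone f →
    ∃ N, ∀ n, N ≤ n → f n = f N

/-- A ring is a left Goldie ring if it has finite left uniform dimension and satisfies
the a.c.c. on left annihilators. -/
def IsLeftGoldieRing (R : Type*) [Ring R] : Prop :=
  HasFiniteLeftUniformDimension R ∧ ACCLeftAnnihilators R

/-- A left ideal is essential if it meets every nonzero left ideal nontrivially. -/
def IsEssentialLeftIdeal {R : Type*} [Ring R] (I : Ideal R) : Prop :=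
  ∀ J : Ideal R, J ≠ ⊥ → I ⊓ J ≠ ⊥

/-- A ring endomorphism has large image if its image contains an essential left ideal. -/
def HasLargeImage {R : Type*} [Ring R] (σ : R →+* R) : Prop :=
  ∃ I : Ideal R, IsEssentialLeftIdeal I ∧ (I : Set R) ⊆ Set.range σ

/-- The left uniform dimension of a module, with values in `ℕ∞`: the supremum of the
numbers `k` such that `M` contains a direct sum of `k` nonzero submodules. -/
noncomputable def udim (R : Type*) [Ring R] (M : Type*) [AddCommGroup M] [Module R M] : ℕ∞ :=
  sSup {n : ℕ∞ | ∃ (k : ℕ) (f : Fin k → Submodule R M),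
    n = (k : ℕ∞) ∧ (∀ i, f i ≠ ⊥) ∧ iSupIndep f}

/-- `DevLE α P` means that the deviation of the poset `P` is at most the ordinal `α`:
for every descending chain, all but finitely many of its factor intervals either are
trivial or have deviation at most some ordinal `β < α`. -/
def DevLE (α : Ordinal.{v}) (P : Type u) [Preorder P] : Prop :=
  ∀ f : ℕ → P, (∀ n, f (n + 1) ≤ f n) →
    ∃ N : ℕ, ∀ n, N ≤ n →
      (∀ x y : Set.Icc (f (n + 1)) (f n), x ≤ y → y ≤ x) ∨
      ∃ (β : Ordinal.{v}) (_ : β < α), DevLE β (Set.Icc (f (n + 1)) (f n))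
termination_by α

/-- A module has (Gabriel–Rentschler) Krull dimension if the deviation of its lattice of
submodules is defined, i.e. bounded by some ordinal. -/
def HasKrullDimGR (R : Type u) [Ring R] (M : Type v) [AddCommGroup M] [Module R M] : Prop :=
  ∃ α : Ordinal.{max u v}, DevLE α (Submodule R M)

/-- The Gabriel–Rentschler Krull dimension of a module: the least ordinal bounding the
deviation of its lattice of submodules. -/
noncomputable def krullDimGR (R : Type u) [Ring R] (M : Type v) [AddCommGroup M]
    [Module R M] : Ordinal.{max u v} :=
  sInf {α : Ordinal.{max u v} | DevLE α (Submodule R M)}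

section Ore

variable {R : Type*} [Ring R]

/-- A multiplicative subset: contains `1`, omits `0` and is closed under multiplication. -/
def IsMultSet (S : Set R) : Prop :=
  1 ∈ S ∧ 0 ∉ S ∧ ∀ s ∈ S, ∀ t ∈ S, s * t ∈ S

/-- A left Ore set: a multiplicative set satisfying the left Ore condition. -/
def IsLeftOreSet (S : Set R) : Prop :=
  IsMultSet S ∧ ∀ (r : R), ∀ s ∈ S, ∃ s' ∈ S, ∃ r' : R, s' * r = r' * s

/-- `assL S = { r | s r = 0 for some s ∈ S }`. -/
def assL (S : Set R) : Set R := {r : R | ∃ s ∈ S, s * r = 0}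

/-- A left denominator set: a left Ore set such that `r s = 0` with `s ∈ S` implies
`t r = 0` for some `t ∈ S`. -/
def IsLeftDenominatorSet (S : Set R) : Prop :=
  IsLeftOreSet S ∧ ∀ (r : R), ∀ s ∈ S, r * s = 0 → ∃ t ∈ S, t * r = 0

/-- `θ : R →+* Q` realizes `Q` as the left localization `S⁻¹R` of `R` at `S`:
elements of `S` become units, the kernel of `θ` is `assL S`, and every element of `Q`
has the form `θ(s)⁻¹ θ(r)`. -/
structure IsLeftLocalization {Q : Type*} [Ring Q] (S : Set R) (θ : R →+* Q) : Prop where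
  isUnit : ∀ s ∈ S, IsUnit (θ s)
  ker_eq : ∀ r : R, θ r = 0 ↔ r ∈ assL S
  exists_rep : ∀ q : Q, ∃ s ∈ S, ∃ r : R, θ s * q = θ r

end Ore

universe u₁ u₂ v₁

/-- The deviation of the poset `P` is strictly smaller than `α`, trivial posets having
deviation `-1`. -/
def DevLT (α : Ordinal.{v₁}) (P : Type u₁) [Preorder P] : Prop :=
  (∀ x y : P, x ≤ y → y ≤ x) ∨ ∃ (β : Ordinal.{v₁}) (_ : β < α), DevLE β P

section Deviation

variable {P : Type u₁} {Q : Type u₂} {α β : Ordinal.{v₁}}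

theorem devLE_iff [Preorder P] :
    DevLE α P ↔ ∀ f : ℕ → P, (∀ n, f (n + 1) ≤ f n) →
      ∃ N : ℕ, ∀ n, N ≤ n → DevLT α (Set.Icc (f (n + 1)) (f n)) := by
  rw [DevLE]
  rfl

theorem DevLT.mono [Preorder P] (h : DevLT α P) (hαβ : α ≤ β) : DevLT β P :=
  h.imp_right fun ⟨δ, hδ, h⟩ => ⟨δ, hδ.trans_le hαβ, h⟩

theorem DevLE.mono [Preorder P] (h : DevLE α P) (hαβ : α ≤ β) : DevLE β P := by
  rw [devLE_iff] at h ⊢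
  intro f hf
  obtain ⟨N, hN⟩ := h f hf
  exact ⟨N, fun n hn => (hN n hn).mono hαβ⟩

theorem DevLE.of_strictMono [Preorder P] [Preorder Q] (h : DevLE α Q) (g : P → Q)
    (hg : StrictMono g) (hg' : Monotone g) : DevLE α P := by
  induction α using WellFoundedLT.induction generalizing P Q with
  | ind α ih =>
    rw [devLE_iff] at h ⊢
    intro f hf
    obtain ⟨N, hN⟩ := h (g ∘ f) fun n => hg' (hf n)
    refine ⟨N, fun n hn => ?_⟩
    let k : Set.Icc (f (n + 1)) (f n) → Set.Icc (g (f (n + 1))) (g (f n)) :=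
      fun x => ⟨g x, hg' x.2.1, hg' x.2.2⟩
    have hk : StrictMono k := fun x y hxy => hg (a := x.1) (b := y.1) hxy
    have hk' : Monotone k := fun x y hxy => hg' (a := x.1) (b := y.1) hxy
    rcases hN n hn with ht | ⟨β, hβ, hd⟩
    · left
      intro x y hxy
      by_contra hyx
      exact (hk (lt_of_le_not_ge hxy hyx)).not_ge (ht _ _ (hk' hxy))
    · exact Or.inr ⟨β, hβ, ih β hβ hd k hk hk'⟩

theorem DevLT.of_strictMono [PartialOrder P] [Preorder Q] (h : DevLT α Q) (g : P → Q)
    (hg : StrictMono g) : DevLT α P := by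
  rcases h with ht | ⟨β, hβ, hd⟩
  · left
    intro x y hxy
    by_contra hyx
    have := hg (lt_of_le_not_ge hxy hyx)
    exact this.not_ge (ht _ _ this.le)
  · exact Or.inr ⟨β, hβ, hd.of_strictMono g hg hg.monotone⟩

theorem DevLE.icc [PartialOrder P] [Preorder Q] {a b : P} {c d : Q}
    (h : DevLE α (Set.Icc c d)) (g : P → Q)
    (hg : ∀ x y, a ≤ x → x < y → y ≤ b → g x < g y)
    (hm : ∀ x, a ≤ x → x ≤ b → c ≤ g x ∧ g x ≤ d) : DevLE α (Set.Icc a b) := by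
  have hk : StrictMono fun x : Set.Icc a b => (⟨g x, hm x x.2.1 x.2.2⟩ : Set.Icc c d) :=
    fun x y hxy => hg x y x.2.1 hxy y.2.2
  exact h.of_strictMono _ hk hk.monotone

theorem DevLT.icc [PartialOrder P] [Preorder Q] {a b : P} {c d : Q}
    (h : DevLT α (Set.Icc c d)) (g : P → Q)
    (hg : ∀ x y, a ≤ x → x < y → y ≤ b → g x < g y)
    (hm : ∀ x, a ≤ x → x ≤ b → c ≤ g x ∧ g x ≤ d) : DevLT α (Set.Icc a b) :=
  h.of_strictMono (fun x : Set.Icc a b => (⟨g x, hm x x.2.1 x.2.2⟩ : Set.Icc c d))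
    fun x y hxy => hg x y x.2.1 hxy y.2.2

theorem devLE_of_trivial [Preorder P] (h : ∀ x y : P, x ≤ y → y ≤ x) : DevLE α P := by
  rw [devLE_iff]
  exact fun f _ => ⟨0, fun n _ => Or.inl fun x y hxy => h x y hxy⟩

theorem DevLE.prod [PartialOrder P] [PartialOrder Q] (hP : DevLE α P) (hQ : DevLE α Q) :
    DevLE α (P × Q) := by
  induction α using WellFoundedLT.induction generalizing P Q with
  | ind α ih =>
    rw [devLE_iff] at hP hQ ⊢
    intro f hf
    obtain ⟨N₁, h₁⟩ := hP (fun n => (f n).1) fun n => (hf n).1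
    obtain ⟨N₂, h₂⟩ := hQ (fun n => (f n).2) fun n => (hf n).2
    refine ⟨max N₁ N₂, fun n hn => ?_⟩
    have d₁ := h₁ n (le_of_max_le_left hn)
    have d₂ := h₂ n (le_of_max_le_right hn)
    let k : Set.Icc (f (n + 1)) (f n) →
        Set.Icc (f (n + 1)).1 (f n).1 × Set.Icc (f (n + 1)).2 (f n).2 :=
      fun x => (⟨x.1.1, x.2.1.1, x.2.2.1⟩, ⟨x.1.2, x.2.1.2, x.2.2.2⟩)
    have hk : StrictMono k := fun x y hxy =>
      lt_of_le_not_ge ⟨hxy.le.1, hxy.le.2⟩ fun h => hxy.not_ge ⟨h.1, h.2⟩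
    refine DevLT.of_strictMono ?_ k hk
    rcases d₁ with t₁ | ⟨β₁, hβ₁, d₁⟩ <;> rcases d₂ with t₂ | ⟨β₂, hβ₂, d₂⟩
    · exact Or.inl fun x y h => ⟨t₁ _ _ h.1, t₂ _ _ h.2⟩
    · exact Or.inr ⟨β₂, hβ₂, ih _ hβ₂ (devLE_of_trivial t₁) d₂⟩
    · exact Or.inr ⟨β₁, hβ₁, ih _ hβ₁ d₁ (devLE_of_trivial t₂)⟩
    · exact Or.inr ⟨max β₁ β₂, max_lt hβ₁ hβ₂,
        ih _ (max_lt hβ₁ hβ₂) (d₁.mono (le_max_left _ _)) (d₂.mono (le_max_right _ _))⟩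

theorem not_devLE_set_nat (α : Ordinal.{v₁}) : ¬ DevLE α (Set ℕ) := by
  induction α using WellFoundedLT.induction with
  | ind α ih =>
    intro h
    rw [devLE_iff] at h
    let f : ℕ → Set ℕ := fun n => {m | n ≤ m.unpair.1}
    have hf : ∀ n, f (n + 1) ≤ f n := fun n m hm => (Nat.le_succ n).trans hm
    obtain ⟨N, hN⟩ := h f hf
    have hg : ∀ X : Set ℕ, f (N + 1) ∪ Nat.pair N '' X ∈ Set.Icc (f (N + 1)) (f N) := by
      refine fun X => ⟨Set.subset_union_left, Set.union_subset (hf N) ?_⟩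
      rintro _ ⟨x, -, rfl⟩
      simp [f]
    have hmono : StrictMono fun X : Set ℕ =>
        (⟨f (N + 1) ∪ Nat.pair N '' X, hg X⟩ : Set.Icc (f (N + 1)) (f N)) := by
      refine fun X Y hXY => lt_of_le_not_ge
        (Set.union_subset_union_right _ (Set.image_mono hXY.le)) fun hle => hXY.not_ge ?_
      intro y hy
      rcases hle (Or.inr ⟨y, hy, rfl⟩) with h | ⟨x, hx, hxy⟩
      · simp [f] at h
      · rwa [← (Nat.pair_eq_pair.mp hxy).2]
    rcases (hN N le_rfl).of_strictMono _ hmono with ht | ⟨β, hβ, hd⟩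
    · exact ht ∅ Set.univ (Set.empty_subset _) (Set.mem_univ 0)
    · exact ih β hβ hd

end Deviation

section Modules

variable {R : Type u₁} [Ring R] {M : Type u₂} [AddCommGroup M] [Module R M]
  {α γ : Ordinal.{v₁}}

theorem iSupIndep_of_disjoint_monotone {C L : ℕ → Submodule R M} (hL : Monotone L)
    (hCL : ∀ n, C n ≤ L (n + 1)) (hd : ∀ n, Disjoint (C n) (L n)) : iSupIndep C := by
  rw [iSupIndep_iff_finsetSum_eq_zero_imp_eq_zero]
  intro s
  induction s using Finset.induction_on_max with
  | empty => simp
  | insert a s hs ih =>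
    intro v hv hsum
    have ha : a ∉ s := fun h => (hs a h).false
    rw [Finset.sum_insert ha] at hsum
    have hmem : ∑ i ∈ s, v i ∈ L a :=
      Submodule.sum_mem _ fun i hi =>
        hL (hs i hi) (hCL i (hv i (Finset.mem_insert_of_mem hi)))
    have hva : v a = 0 := by
      refine (Submodule.disjoint_def.mp (hd a)) _ (hv a (Finset.mem_insert_self _ _)) ?_
      rw [eq_neg_of_add_eq_zero_left hsum]
      exact neg_mem hmem
    rw [hva, zero_add] at hsum
    intro i hi
    rcases Finset.mem_insert.mp hi with rfl | hi
    · exact hva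
    · exact ih v (fun j hj => hv j (Finset.mem_insert_of_mem hj)) hsum i hi

theorem DevLE.not_iSupIndep (h : DevLE α (Submodule R M)) {C : ℕ → Submodule R M}
    (hC : ∀ n, C n ≠ ⊥) : ¬ iSupIndep C := by
  intro hind
  have hmono : StrictMono fun X : Set ℕ => ⨆ i ∈ X, C i := by
    intro X Y hXY
    refine lt_of_le_not_ge (biSup_mono hXY.le) fun hle => ?_
    obtain ⟨i, hiY, hiX⟩ := Set.exists_of_ssubset hXY
    refine hC i ((hind.disjoint_biSup hiX).eq_bot_of_le ?_)
    exact (le_biSup C hiY).trans hle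
  exact not_devLE_set_nat α (h.of_strictMono _ hmono hmono.monotone)

/-- A nonzero submodule which is critical of deviation `γ`. -/
structure IsCriticalSubmodule (γ : Ordinal.{v₁}) (C : Submodule R M) : Prop where
  ne_bot : C ≠ ⊥
  devLE : DevLE γ (Set.Icc ⊥ C)
  not_devLT : ∀ E ≤ C, E ≠ ⊥ → ¬ DevLT γ (Set.Icc ⊥ E)
  devLT : ∀ E ≤ C, E ≠ ⊥ → DevLT γ (Set.Icc E C)

theorem DevLE.exists_isCriticalSubmodule (h : DevLE α (Submodule R M)) {L : Submodule R M}
    (hL : L ≠ ⊥) : ∃ (C : Submodule R M) (γ : Ordinal.{v₁}), C ≤ L ∧ IsCriticalSubmodule γ C := by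
  let S : Set Ordinal.{v₁} := {γ | ∃ E ≤ L, E ≠ ⊥ ∧ DevLE γ (Set.Icc ⊥ E)}
  have hS : S.Nonempty := ⟨α, L, le_rfl, hL,
    h.of_strictMono (Subtype.val : Set.Icc ⊥ L → _) (fun _ _ h => h) (fun _ _ h => h)⟩
  obtain ⟨E, hEL, hE, hdev⟩ := csInf_mem hS
  set γ := sInf S
  have hmin : ∀ F ≤ E, F ≠ ⊥ → ¬ DevLT γ (Set.Icc ⊥ F) := by
    rintro F hFE hF (ht | ⟨β, hβ, hd⟩)
    · exact hF (le_bot_iff.mp (ht ⟨⊥, le_rfl, bot_le⟩ ⟨F, bot_le, le_rfl⟩ (bot_le (a := F))))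
    · exact notMem_of_lt_csInf' hβ ⟨F, hFE.trans hEL, hF, hd⟩
  by_contra! hno
  have step : ∀ C : {C : Submodule R M // C ≤ E ∧ C ≠ ⊥},
      ∃ C' : {C : Submodule R M // C ≤ E ∧ C ≠ ⊥}, C'.1 ≤ C.1 ∧ ¬ DevLT γ (Set.Icc C'.1 C.1) := by
    rintro ⟨C, hCE, hC⟩
    by_contra! hcon
    refine hno C γ (hCE.trans hEL) ⟨hC, ?_, fun F hF => hmin F (hF.trans hCE),
      fun F hF hF0 => hcon ⟨F, hF.trans hCE, hF0⟩ hF⟩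
    exact hdev.icc id (fun _ _ _ h _ => h) fun x hx hxC => ⟨hx, hxC.trans hCE⟩
  choose next hle hnext using step
  let c : ℕ → {C : Submodule R M // C ≤ E ∧ C ≠ ⊥} := fun n => next^[n] ⟨E, le_rfl, hE⟩
  have hc : ∀ n, c (n + 1) = next (c n) := fun n => Function.iterate_succ_apply' _ _ _
  rw [devLE_iff] at hdev
  obtain ⟨N, hN⟩ := hdev (fun n => ⟨(c n).1, bot_le, (c n).2.1⟩) fun n => by
    change (c (n + 1)).1 ≤ (c n).1
    rw [hc]
    exact hle _
  refine hnext (c N) ?_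
  rw [← hc]
  refine (hN N le_rfl).of_strictMono
    (fun x => ⟨⟨x.1, bot_le, x.2.2.trans (c N).2.1⟩, x.2.1, x.2.2⟩) fun x y hxy => hxy

theorem Submodule.map_lt_map_of_disjoint_ker {N : Type*} [AddCommGroup N] [Module R N]
    (f : M →ₗ[R] N) {E F A : Submodule R M} (hA : Disjoint A (LinearMap.ker f)) (hEF : E < F)
    (hFA : F ≤ A) : E.map f < F.map f := by
  refine lt_of_le_not_ge (Submodule.map_mono hEF.le) fun hle => hEF.not_ge fun x hx => ?_
  obtain ⟨y, hy, hyx⟩ := hle (Submodule.mem_map_of_mem hx)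
  have h0 : x - y = 0 := Submodule.disjoint_def.mp hA _
    (A.sub_mem (hFA hx) (hFA (hEF.le hy))) (by simp [hyx])
  rwa [sub_eq_zero.mp h0]

theorem DevLE.icc_sup (A B : Submodule R M) (hA : DevLE γ (Set.Icc ⊥ A))
    (hB : DevLE γ (Set.Icc ⊥ B)) : DevLE γ (Set.Icc ⊥ (A ⊔ B)) := by
  let k : Set.Icc ⊥ (A ⊔ B) → Set.Icc ⊥ B × Set.Icc ⊥ A := fun E =>
    (⟨E.1 ⊓ B, bot_le, inf_le_right⟩, ⟨(E.1 ⊔ B) ⊓ A, bot_le, inf_le_right⟩)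
  have hmono : Monotone k := by
    intro E F hEF
    have hEF' : E.1 ≤ F.1 := hEF
    have h₁ : E.1 ⊓ B ≤ F.1 ⊓ B := inf_le_inf_right _ hEF'
    have h₂ : (E.1 ⊔ B) ⊓ A ≤ (F.1 ⊔ B) ⊓ A := inf_le_inf_right _ (sup_le_sup_right hEF' _)
    exact ⟨h₁, h₂⟩
  have hinj : ∀ E F, E ≤ F → k F ≤ k E → F ≤ E := by
    intro E F hEF hle
    have hEF' : E.1 ≤ F.1 := hEF
    have h₁ : F.1 ⊓ B ≤ E.1 ⊓ B := hle.1
    have h₂ : (F.1 ⊔ B) ⊓ A ≤ (E.1 ⊔ B) ⊓ A := hle.2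
    have key : ∀ X : Submodule R M, X ≤ A ⊔ B → X ⊔ B = (X ⊔ B) ⊓ A ⊔ B := fun X hX => by
      rw [inf_sup_assoc_of_le _ le_sup_right, inf_eq_left.mpr (sup_le hX le_sup_right)]
    refine (eq_of_le_of_inf_le_of_sup_le (z := B) hEF' h₁ ?_).ge
    rw [key F.1 F.2.2, key E.1 E.2.2]
    exact sup_le_sup_right h₂ _
  exact (hB.prod hA).of_strictMono k (fun E F hEF =>
    lt_of_le_not_ge (hmono hEF.le) fun h => hEF.not_ge (hinj E F hEF.le h)) hmono

/-- If `D` embeds in a submodule `K ≤ D` of deviation at most `γ` by an endomorphism of the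
ambient module, then `D / K` has deviation less than `γ`. -/
theorem DevLE.devLT_icc_of_map_le {f : M →ₗ[R] M} {K D : Submodule R M}
    (hK : DevLE γ (Set.Icc ⊥ K)) (hKD : K ≤ D) (hD : Disjoint D (LinearMap.ker f))
    (hmap : D.map f ≤ K) : DevLT γ (Set.Icc K D) := by
  have hle : ∀ n (E : Submodule R M), E ≤ D → (Submodule.map f)^[n] E ≤ D := by
    intro n
    induction n with
    | zero => exact fun E hE => hE
    | succ n ih => exact fun E hE => ih _ ((Submodule.map_mono hE).trans (hmap.trans hKD))
  have hmono : ∀ n, Monotone ((Submodule.map f)^[n]) := fun n =>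
    Monotone.iterate (fun _ _ h => Submodule.map_mono h) n
  have hlt : ∀ n (E F : Submodule R M), E < F → F ≤ D →
      (Submodule.map f)^[n] E < (Submodule.map f)^[n] F := by
    intro n
    induction n with
    | zero => exact fun E F h _ => h
    | succ n ih =>
      exact fun E F h hF => ih _ _ (Submodule.map_lt_map_of_disjoint_ker f hD h hF)
        ((Submodule.map_mono hF).trans (hmap.trans hKD))
  have hin : ∀ n, (Submodule.map f)^[n + 1] D ≤ K := fun n => by
    rw [Function.iterate_succ_apply']
    exact (Submodule.map_mono (hle n D le_rfl)).trans hmap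
  rw [devLE_iff] at hK
  obtain ⟨N, hN⟩ := hK (fun n => ⟨(Submodule.map f)^[n + 1] D, bot_le, hin n⟩)
    fun n => hmono (n + 1) (hmap.trans hKD)
  have hbd : ∀ x : Set.Icc K D,
      (Submodule.map f)^[N + 1 + 1] D ≤ (Submodule.map f)^[N + 1] x.1 ∧
        (Submodule.map f)^[N + 1] x.1 ≤ (Submodule.map f)^[N + 1] D :=
    fun x => ⟨hmono (N + 1) (hmap.trans x.2.1), hmono (N + 1) x.2.2⟩
  exact (hN N le_rfl).of_strictMono
    (fun x => ⟨⟨(Submodule.map f)^[N + 1] x.1, bot_le, (hbd x).2.trans (hin N)⟩, hbd x⟩)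
    fun x y hxy => hlt (N + 1) x.1 y.1 hxy y.2.2

theorem IsCriticalSubmodule.disjoint_ker {C : Submodule R M} (hC : IsCriticalSubmodule γ C)
    {f : M →ₗ[R] M} (hf : C.map f ≤ C) (hf0 : C.map f ≠ ⊥) : Disjoint C (LinearMap.ker f) := by
  by_contra hdis
  refine hC.not_devLT _ hf hf0 ((hC.devLT (C ⊓ LinearMap.ker f) inf_le_left
    fun h => hdis (disjoint_iff.mpr h)).icc (fun E => C ⊓ E.comap f) ?_ ?_)
  · intro X Y _ hXY hY
    refine lt_of_le_not_ge (inf_le_inf_left _ (Submodule.comap_mono hXY.le))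
      fun hle => hXY.not_ge fun z hz => ?_
    obtain ⟨w, hw, rfl⟩ := hY hz
    exact (hle ⟨hw, hz⟩).2
  · exact fun X _ _ => ⟨inf_le_inf_left _ (Submodule.comap_mono bot_le), inf_le_left⟩

end Modules

section Rings

variable {R : Type u₁} [Ring R] {α : Ordinal.{v₁}}

theorem IsSemiprimeRing'.exists_mul_ne_zero (h : IsSemiprimeRing' R) {C : Ideal R} (hC : C ≠ ⊥) :
    ∃ c ∈ C, ∃ d ∈ C, d * c ≠ 0 := by
  by_contra! hsq
  let J : TwoSidedIdeal R := TwoSidedIdeal.mk'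
    {x | (∀ c ∈ C, x * c = 0) ∧ ∀ a, (∀ c ∈ C, a * c = 0) → a * x = 0}
    ⟨fun c _ => zero_mul c, fun a _ => mul_zero a⟩
    (fun {x y} hx hy => ⟨fun c hc => by rw [add_mul, hx.1 c hc, hy.1 c hc, add_zero],
      fun a ha => by rw [mul_add, hx.2 a ha, hy.2 a ha, add_zero]⟩)
    (fun {x} hx => ⟨fun c hc => by rw [neg_mul, hx.1 c hc, neg_zero],
      fun a ha => by rw [mul_neg, hx.2 a ha, neg_zero]⟩)
    (fun {x y} hy => ⟨fun c hc => by rw [mul_assoc, hy.1 c hc, mul_zero],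
      fun a ha => by
        rw [← mul_assoc]
        exact hy.2 _ fun c hc => by rw [mul_assoc]; exact ha _ (C.mul_mem_left x hc)⟩)
    (fun {x y} hx => ⟨fun c hc => by rw [mul_assoc]; exact hx.1 _ (C.mul_mem_left y hc),
      fun a ha => by rw [← mul_assoc, hx.2 a ha, zero_mul]⟩)
  have hJ : J = ⊥ := by
    refine h J ⟨2, two_pos, fun f hf => ?_⟩
    have h0 := (TwoSidedIdeal.mem_mk' _ _ _ _ _ _ _).mp (hf 0)
    have h1 := (TwoSidedIdeal.mem_mk' _ _ _ _ _ _ _).mp (hf 1)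
    simpa using h1.2 _ h0.1
  refine hC (le_bot_iff.mp fun x hx => ?_)
  have hxJ : x ∈ J := (TwoSidedIdeal.mem_mk' _ _ _ _ _ _ _).mpr
    ⟨fun c hc => hsq c hc x hx, fun a ha => ha x hx⟩
  rwa [hJ] at hxJ

theorem IsSemiprimeRing'.exists_disjoint_ker (h : IsSemiprimeRing' R) {C : Ideal R}
    (hC : IsCriticalSubmodule α C) :
    ∃ c ∈ C, Disjoint C (LinearMap.ker (LinearMap.toSpanSingleton R R c)) := by
  obtain ⟨c, hc, d, hd, hdc⟩ := h.exists_mul_ne_zero hC.ne_bot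
  refine ⟨c, hc, hC.disjoint_ker ?_ fun h0 => hdc ?_⟩
  · rintro _ ⟨x, -, rfl⟩
    exact C.mul_mem_left x hc
  · exact (Submodule.mem_bot R).mp (h0 ▸ Submodule.mem_map_of_mem hd)

theorem IsEssentialLeftIdeal.eq_zero_of_mul_eq_zero (h : IsSemiprimeRing' R)
    (hdev : DevLE α (Ideal R)) {I : Ideal R} (hI : IsEssentialLeftIdeal I) {x : R}
    (hx : ∀ y ∈ I, y * x = 0) : x = 0 := by
  by_contra hx0
  obtain ⟨C, γ, hCx, hC⟩ := DevLE.exists_isCriticalSubmodule hdev (L := Ideal.span {x})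
    (by simpa [Ideal.span_singleton_eq_bot] using hx0)
  obtain ⟨c, hc, hdis⟩ := h.exists_disjoint_ker hC
  obtain ⟨r, rfl⟩ := Ideal.mem_span_singleton'.mp (hCx hc)
  obtain ⟨y, hy, hy0, hyr⟩ : ∃ y ∈ C, y ≠ 0 ∧ y * r ∈ I := by
    obtain ⟨e, he, he0⟩ := Submodule.exists_mem_ne_zero_of_ne_bot hC.ne_bot
    by_cases her : e * r = 0
    · exact ⟨e, he, he0, her ▸ I.zero_mem⟩
    · obtain ⟨z, ⟨hzI, hz⟩, hz0⟩ := Submodule.exists_mem_ne_zero_of_ne_bot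
        (hI (Ideal.span {e * r}) (by simpa [Ideal.span_singleton_eq_bot] using her))
      obtain ⟨s, rfl⟩ := Ideal.mem_span_singleton'.mp hz
      refine ⟨s * e, Ideal.mul_mem_left C s he, fun h0 => hz0 ?_, by rwa [mul_assoc]⟩
      rw [← mul_assoc, h0, zero_mul]
  refine hy0 (Submodule.disjoint_def.mp hdis y hy ?_)
  rw [LinearMap.mem_ker, LinearMap.toSpanSingleton_apply, smul_eq_mul, ← mul_assoc]
  exact hx _ hyr

theorem DevLE.wellFounded_disjoint_sup {M : Type u₂} [AddCommGroup M] [Module R M]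
    (hdev : DevLE α (Submodule R M)) :
    WellFounded fun L' L : Submodule R M => ∃ C ≠ ⊥, Disjoint C L ∧ L' = L ⊔ C := by
  rw [wellFounded_iff_isEmpty_descending_chain]
  refine ⟨fun ⟨L, hL⟩ => ?_⟩
  choose C hC hd hsup using hL
  refine hdev.not_iSupIndep hC (iSupIndep_of_disjoint_monotone (L := L) ?_ ?_ hd)
  · exact monotone_nat_of_le_succ fun n => by rw [hsup n]; exact le_sup_left
  · exact fun n => by rw [hsup n]; exact le_sup_right

/-- A nonzero left ideal `K` contains an element whose left annihilator avoids `K`; the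
deviation of `K` is attained on a critical left ideal. -/
theorem IsSemiprimeRing'.exists_mem_disjoint_ker (h : IsSemiprimeRing' R)
    (hdev : DevLE α (Ideal R)) {K : Ideal R} (hK : K ≠ ⊥) :
    ∃ k ∈ K, Disjoint K (LinearMap.ker (LinearMap.toSpanSingleton R R k)) ∧
      ∃ (γ : Ordinal.{v₁}) (C : Ideal R), C ≤ K ∧ IsCriticalSubmodule γ C ∧
        DevLE γ (Set.Icc ⊥ K) := by
  let S : Set (Ideal R) := {L | L ≤ K ∧ (∃ k ∈ L,
    Disjoint L (LinearMap.ker (LinearMap.toSpanSingleton R R k))) ∧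
      ∃ (γ : Ordinal.{v₁}) (C : Ideal R), C ≤ K ∧ IsCriticalSubmodule γ C ∧
        DevLE γ (Set.Icc ⊥ L)}
  have hS : S.Nonempty := by
    obtain ⟨C, γ, hCK, hC⟩ := DevLE.exists_isCriticalSubmodule hdev hK
    exact ⟨C, hCK, h.exists_disjoint_ker hC, γ, C, hCK, hC, hC.devLE⟩
  obtain ⟨L, ⟨hLK, ⟨k, hk, hdis⟩, γ, C, hCK, hC, hL⟩, hmin⟩ :=
    hdev.wellFounded_disjoint_sup.has_min S hS
  by_cases hKk : Disjoint K (LinearMap.ker (LinearMap.toSpanSingleton R R k))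
  · refine ⟨k, hLK hk, hKk, γ, C, hCK, hC,
      hL.icc (Submodule.map (LinearMap.toSpanSingleton R R k))
        (fun X Y _ hXY hY => Submodule.map_lt_map_of_disjoint_ker _ hKk hXY hY)
        fun X _ _ => ⟨bot_le, ?_⟩⟩
    rintro _ ⟨x, -, rfl⟩
    exact Ideal.mul_mem_left L x hk
  obtain ⟨C', γ', hC'K, hC'⟩ := DevLE.exists_isCriticalSubmodule hdev
    fun h0 => hKk (disjoint_iff.mpr h0)
  obtain ⟨c, hc, hcdis⟩ := h.exists_disjoint_ker hC'
  have hC'k : ∀ y ∈ C', y * k = 0 := fun y hy => (hC'K hy).2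
  have hLC' : Disjoint C' L := Submodule.disjoint_def.mpr fun y hy hyL =>
    Submodule.disjoint_def.mp hdis y hyL (hC'K hy).2
  refine absurd ⟨C', hC'.ne_bot, hLC', rfl⟩ (hmin (L ⊔ C') ⟨sup_le hLK (hC'K.trans inf_le_left),
    ⟨k + c, Submodule.add_mem_sup hk hc, ?_⟩, ?_⟩)
  · refine Submodule.disjoint_def.mpr fun x hx hxk => ?_
    have hxk' : x * k + x * c = 0 := by
      simpa [LinearMap.mem_ker, mul_add] using hxk
    have hxc : x * c = 0 := Submodule.disjoint_def.mp hLC' _ (Ideal.mul_mem_left C' x hc) <| by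
      rw [eq_neg_of_add_eq_zero_right hxk']
      exact neg_mem (Ideal.mul_mem_left L x hk)
    rw [hxc, add_zero] at hxk'
    obtain ⟨m, hm, y, hy, rfl⟩ := Submodule.mem_sup.mp hx
    have hm0 : m = 0 := Submodule.disjoint_def.mp hdis m hm <| by
      simpa [LinearMap.mem_ker, add_mul, hC'k y hy] using hxk'
    subst hm0
    rw [zero_add] at hxc ⊢
    exact Submodule.disjoint_def.mp hcdis y hy (by simpa [LinearMap.mem_ker] using hxc)
  · rcases le_total γ γ' with hγ | hγ
    · exact ⟨γ', C', hC'K.trans inf_le_left, hC', DevLE.icc_sup _ _ (hL.mono hγ) hC'.devLE⟩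
    · exact ⟨γ, C, hCK, hC, DevLE.icc_sup _ _ hL (hC'.devLE.mono hγ)⟩

/-- Every nonzero left ideal inside `C` has deviation at least `γ`. -/
def HereditarilyDevGE (γ : Ordinal.{v₁}) (C : Ideal R) : Prop :=
  ∀ E ≤ C, E ≠ ⊥ → ¬ DevLT γ (Set.Icc ⊥ E)

theorem HereditarilyDevGE.of_le_comap (h : IsSemiprimeRing' R) (hdev : DevLE α (Ideal R))
    {σ : R →+* R} {I : Ideal R} (hI : IsEssentialLeftIdeal I) (hσ : (I : Set R) ⊆ Set.range σ)
    {γ : Ordinal.{v₁}} {C C' : Ideal R} (hC : HereditarilyDevGE γ C) (hC' : C' ≤ C.comap σ)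
    (hker : Disjoint C' (RingHom.ker σ)) : HereditarilyDevGE γ C' := by
  intro E hE hE0 hlt
  obtain ⟨x, hx, hx0⟩ := Submodule.exists_mem_ne_zero_of_ne_bot hE0
  have hσx : σ x ≠ 0 := fun h0 => hx0 (Submodule.disjoint_def.mp hker x (hE hx) h0)
  let F : Ideal R := Submodule.map (LinearMap.toSpanSingleton R R (σ x)) I
  have hFC : F ≤ C := by
    rintro _ ⟨y, -, rfl⟩
    exact C.mul_mem_left y (hC' (hE hx))
  have hF0 : F ≠ ⊥ := fun h0 => hσx <| hI.eq_zero_of_mul_eq_zero h hdev fun y hy =>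
    (Submodule.mem_bot R).mp (h0 ▸ Submodule.mem_map_of_mem hy)
  refine hC F hFC hF0 (hlt.icc (fun X => E ⊓ X.comap σ) ?_ fun X _ _ => ⟨bot_le, inf_le_left⟩)
  intro X Y _ hXY hY
  refine lt_of_le_not_ge (inf_le_inf_left _ (Ideal.comap_mono hXY.le))
    fun hle => hXY.not_ge fun z hz => ?_
  obtain ⟨y, hy, rfl⟩ := hY hz
  obtain ⟨s, rfl⟩ := hσ hy
  have hsx : s * x ∈ E ⊓ Y.comap σ := ⟨E.mul_mem_left s hx, by
    simpa [Ideal.mem_comap] using hz⟩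
  simpa [Ideal.mem_comap] using (hle hsx).2

theorem devLT_icc_of_devLT_icc_ker_comap {σ : R →+* R} {C : Ideal R} {γ : Ordinal.{v₁}}
    (hσ : (C : Set R) ⊆ Set.range σ) (h : DevLT γ (Set.Icc (RingHom.ker σ) (C.comap σ))) :
    DevLT γ (Set.Icc ⊥ C) := by
  refine h.icc (Ideal.comap σ) (fun X Y _ hXY hY => ?_) fun X _ hX =>
    ⟨Ideal.comap_mono bot_le, Ideal.comap_mono hX⟩
  refine lt_of_le_not_ge (Ideal.comap_mono hXY.le) fun hle => hXY.not_ge fun z hz => ?_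
  obtain ⟨y, rfl⟩ := hσ (hY hz)
  exact hle hz

theorem exists_le_comap_disjoint_ker {σ : R →+* R} {C : Ideal R} {γ : Ordinal.{v₁}} (hC : C ≠ ⊥)
    (hσ : (C : Set R) ⊆ Set.range σ) (hCγ : HereditarilyDevGE γ C) {k : R}
    (hk : k ∈ RingHom.ker σ)
    (hkdis : Disjoint (RingHom.ker σ) (LinearMap.ker (LinearMap.toSpanSingleton R R k)))
    (hK : DevLE γ (Set.Icc ⊥ (RingHom.ker σ))) :
    ∃ C' ≤ C.comap σ, C' ≠ ⊥ ∧ Disjoint C' (RingHom.ker σ) := by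
  by_contra! hno
  refine hCγ C le_rfl hC (devLT_icc_of_devLT_icc_ker_comap hσ
    (hK.devLT_icc_of_map_le (f := LinearMap.toSpanSingleton R R k)
      (Ideal.comap_mono bot_le) ?_ ?_))
  · by_contra hD
    refine hno _ inf_le_left (fun h0 => hD (disjoint_iff.mpr h0)) ?_
    exact hkdis.symm.mono_left inf_le_right
  · rintro _ ⟨x, -, rfl⟩
    exact Ideal.mul_mem_left _ x hk

theorem DevLE.false_of_forall_exists_le_comap (hdev : DevLE α (Ideal R)) {σ : R →+* R}
    {p : Ideal R → Prop} {C₀ : Ideal R} (h₀ : p C₀) (hC₀ : C₀ ≤ RingHom.ker σ)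
    (hp : ∀ C, p C → C ≠ ⊥)
    (hstep : ∀ C, p C → ∃ C', p C' ∧ C' ≤ C.comap σ ∧ Disjoint C' (RingHom.ker σ)) : False := by
  choose next hnext hle hdis using fun C : {C // p C} => hstep C.1 C.2
  let c : ℕ → {C // p C} := fun n => (fun C => ⟨next C, hnext C⟩)^[n] ⟨C₀, h₀⟩
  have hc : ∀ n, (c (n + 1)).1 = next (c n) := fun n => by
    simp only [c, Function.iterate_succ_apply']
  refine hdev.not_iSupIndep (C := fun n => (c n).1) (fun n => hp _ (c n).2)
    (iSupIndep_of_disjoint_monotone (L := fun n => RingHom.ker (σ ^ n)) ?_ ?_ ?_)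
  · refine monotone_nat_of_le_succ fun n x hx => ?_
    rw [RingHom.mem_ker] at hx ⊢
    rw [pow_succ', RingHom.mul_def, RingHom.comp_apply, hx, map_zero]
  · intro n
    induction n with
    | zero => rwa [zero_add, pow_one]
    | succ n ih =>
      intro x hx
      have hx' : x ∈ next (c n) := hc n ▸ hx
      have := ih (hle _ hx')
      rwa [RingHom.mem_ker, pow_succ, RingHom.mul_def, RingHom.comp_apply]
  · intro n
    refine Submodule.disjoint_def.mpr ?_
    induction n with
    | zero => exact fun x _ hx => by simpa [RingHom.mem_ker] using hx
    | succ n ih =>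
      intro x hx hx0
      have hx' : x ∈ next (c n) := hc n ▸ hx
      rw [RingHom.mem_ker, pow_succ, RingHom.mul_def, RingHom.comp_apply] at hx0
      exact Submodule.disjoint_def.mp (hdis _) x hx' (ih _ (hle _ hx') hx0)

end Rings

/-- **Theorem 1.2.** Every endomorphism with large image of a semiprime ring with
(Gabriel–Rentschler) Krull dimension is a monomorphism. -/
theorem injective_of_large_endomorphism_of_krull {R : Type u} [Ring R]
    (hsemiprime : IsSemiprimeRing' R) (hkrull : HasKrullDimGR R R)
    (σ : R →+* R) (hlarge : HasLargeImage σ) :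
    Function.Injective σ := by
  obtain ⟨α, hdev⟩ := hkrull
  obtain ⟨I, hI, hσ⟩ := hlarge
  rw [RingHom.injective_iff_ker_eq_bot]
  by_contra hK
  obtain ⟨k, hk, hkdis, γ, C, hCK, hC, hKγ⟩ := hsemiprime.exists_mem_disjoint_ker hdev hK
  refine DevLE.false_of_forall_exists_le_comap hdev (σ := σ) (C₀ := I ⊓ C)
    (p := fun C => C ≠ ⊥ ∧ C ≤ I ∧ HereditarilyDevGE γ C)
    ⟨hI C hC.ne_bot, inf_le_left, fun E hE => hC.not_devLT E (hE.trans inf_le_right)⟩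
    (inf_le_right.trans hCK) (fun C hC => hC.1) ?_
  rintro C ⟨hC0, hCI, hCγ⟩
  obtain ⟨C', hC'C, hC'0, hC'⟩ :=
    exists_le_comap_disjoint_ker hC0 (subset_trans hCI hσ) hCγ hk hkdis hKγ
  have hle : I ⊓ C' ≤ C.comap σ := inf_le_right.trans hC'C
  have hdis : Disjoint (I ⊓ C') (RingHom.ker σ) := hC'.mono_left inf_le_right
  exact ⟨I ⊓ C', ⟨hI C' hC'0, inf_le_left,
    hCγ.of_le_comap hsemiprime hdev hI hσ hle hdis⟩, hle, hdis⟩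
end

section
/- Let R be a semiprime left Noetherian ring and let σ be a ring endomorphism of R with large image. Then σ is injective. -/
/-- In a semiprime ring, `a R a = 0` forces `a = 0`. -/
theorem IsSemiprimeRing'.eq_zero_of_forall_mul_mul_eq_zero {R : Type*} [Ring R]
    (hR : IsSemiprimeRing' R) {a : R} (ha : ∀ r, a * r * a = 0) : a = 0 := by
  have hleft : ∀ x ∈ TwoSidedIdeal.span {a}, ∀ r, x * r * a = 0 := by
    intro x hx
    let J : TwoSidedIdeal R := TwoSidedIdeal.mk' {x | ∀ r, x * r * a = 0}
      (by simp)
      (by intro x y hx hy r; simp [add_mul, hx r, hy r])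
      (by intro x hx r; simp [hx r])
      (by intro x y hy r; simp only [mul_assoc] at hy ⊢; simp [hy r])
      (by intro x y hx r; simpa only [mul_assoc] using hx (y * r))
    have hJ : x ∈ J := TwoSidedIdeal.mem_span_iff.mp hx J (by
      simpa [J, TwoSidedIdeal.mem_mk'] using ha)
    simpa [J, TwoSidedIdeal.mem_mk'] using hJ
  have hmul : ∀ x ∈ TwoSidedIdeal.span {a}, ∀ y ∈ TwoSidedIdeal.span {a}, x * y = 0 := by
    intro x hx y hy
    let J : TwoSidedIdeal R := TwoSidedIdeal.mk' {y | ∀ r, x * r * y = 0}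
      (by simp)
      (by intro y z hy hz r; simp [mul_add, hy r, hz r])
      (by intro y hy r; simp [hy r])
      (by intro z y hy r; simpa only [mul_assoc] using hy (r * z))
      (by intro y z hy r; rw [← mul_assoc, hy r, zero_mul])
    have hJ : y ∈ J := TwoSidedIdeal.mem_span_iff.mp hy J (by
      simpa [J, TwoSidedIdeal.mem_mk'] using hleft x hx)
    have hJ' : ∀ r, x * r * y = 0 := by simpa [J, TwoSidedIdeal.mem_mk'] using hJ
    simpa using hJ' 1
  have hbot : TwoSidedIdeal.span {a} = ⊥ := by
    refine hR _ ⟨2, by norm_num, fun f hf => ?_⟩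
    simpa [List.ofFn_succ] using hmul _ (hf 0) _ (hf 1)
  have hmem : a ∈ TwoSidedIdeal.span {a} := TwoSidedIdeal.subset_span rfl
  rw [hbot] at hmem
  exact (TwoSidedIdeal.mem_bot R).mp hmem

/-- The left annihilator of an element, as a left ideal. -/
def leftAnnihilatorIdeal {R : Type*} [Ring R] (a : R) : Ideal R :=
  LinearMap.ker (LinearMap.toSpanSingleton R R a)

theorem mem_leftAnnihilatorIdeal {R : Type*} [Ring R] {a x : R} :
    x ∈ leftAnnihilatorIdeal a ↔ x * a = 0 := by
  simp [leftAnnihilatorIdeal]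

/-- A semiprime left Noetherian ring has no nonzero element generating a nil right ideal. -/
theorem IsSemiprimeRing'.eq_zero_of_forall_isNilpotent_mul {R : Type*} [Ring R]
    [IsNoetherianRing R] (hR : IsSemiprimeRing' R) {a : R}
    (ha : ∀ r, IsNilpotent (a * r)) : a = 0 := by
  by_contra ha0
  obtain ⟨_, ⟨b, ⟨hb0, hb⟩, rfl⟩, hmax⟩ := set_has_maximal_iff_noetherian.mpr
    (inferInstance : IsNoetherian R R)
    (leftAnnihilatorIdeal '' {b : R | b ≠ 0 ∧ ∀ r, IsNilpotent (b * r)})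
    ⟨_, a, ⟨ha0, ha⟩, rfl⟩
  refine hb0 (hR.eq_zero_of_forall_mul_mul_eq_zero fun r => ?_)
  by_cases hbr : b * r = 0
  · simp [hbr]
  obtain ⟨n, hn, hpow⟩ : ∃ n, (b * r) ^ (n + 1) ≠ 0 ∧ (b * r) ^ (n + 2) = 0 := by
    classical
    have hex := hb r
    have hspec := Nat.find_spec hex
    have hmin := fun m => Nat.find_min hex (m := m)
    generalize Nat.find hex = k at hspec hmin
    match k, hspec, hmin with
    | 0, h, _ => exact absurd (by rw [← mul_one (b * r), ← pow_zero (b * r), h, mul_zero]) hbr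
    | 1, h, _ => exact absurd (by simpa using h) hbr
    | n + 2, h, hmin => exact ⟨n, hmin (n + 1) (by omega), h⟩
  have hfac : (b * r) ^ (n + 1) = b * (r * (b * r) ^ n) := by rw [pow_succ', mul_assoc]
  have hle : leftAnnihilatorIdeal b ≤ leftAnnihilatorIdeal ((b * r) ^ (n + 1)) := by
    intro x hx
    rw [mem_leftAnnihilatorIdeal] at hx ⊢
    rw [hfac, ← mul_assoc, hx, zero_mul]
  have hnlt := hmax _ ⟨(b * r) ^ (n + 1), ⟨hn, fun s => by
    rw [hfac, mul_assoc]; exact hb _⟩, rfl⟩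
  have hge : leftAnnihilatorIdeal ((b * r) ^ (n + 1)) ≤ leftAnnihilatorIdeal b := by
    by_contra h
    exact hnlt (lt_of_le_not_ge hle h)
  rw [← mem_leftAnnihilatorIdeal]
  apply hge
  rw [mem_leftAnnihilatorIdeal, ← pow_succ', hpow]

/-- Every nonzero left ideal of a semiprime left Noetherian ring contains a nonzero element
`b` such that `b` and `b * b` have the same left annihilator. -/
theorem IsSemiprimeRing'.exists_mem_ne_zero_mul_mul_eq_zero {R : Type*} [Ring R]
    [IsNoetherianRing R] (hR : IsSemiprimeRing' R) {L : Ideal R} (hL : L ≠ ⊥) :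
    ∃ b ∈ L, b ≠ 0 ∧ ∀ x, x * b * b = 0 → x * b = 0 := by
  obtain ⟨a, haL, ha0⟩ := Submodule.exists_mem_ne_zero_of_ne_bot hL
  obtain ⟨r, hr⟩ : ∃ r, ¬ IsNilpotent (a * r) := by
    by_contra! h
    exact ha0 (hR.eq_zero_of_forall_isNilpotent_mul h)
  have hra : ¬ IsNilpotent (r * a) := by
    rintro ⟨n, hn⟩
    refine hr ⟨n + 1, ?_⟩
    rw [pow_succ, ← mul_assoc, mul_pow_mul, hn]
    simp
  have hmono : Monotone fun n => leftAnnihilatorIdeal ((r * a) ^ n) := by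
    refine monotone_nat_of_le_succ fun n x hx => ?_
    rw [mem_leftAnnihilatorIdeal] at hx ⊢
    rw [pow_succ, ← mul_assoc, hx, zero_mul]
  obtain ⟨n, hn⟩ := monotone_stabilizes_iff_noetherian.mpr
    (inferInstance : IsNoetherian R R) ⟨_, hmono⟩
  have hn' : ∀ m, n ≤ m →
      leftAnnihilatorIdeal ((r * a) ^ n) = leftAnnihilatorIdeal ((r * a) ^ m) := hn
  refine ⟨(r * a) ^ (n + 1), ?_, fun h => hra ⟨_, h⟩, fun x hx => ?_⟩
  · rw [pow_succ, ← mul_assoc]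
    exact L.mul_mem_left _ haL
  · rw [mul_assoc, ← pow_add] at hx
    rw [← mem_leftAnnihilatorIdeal] at hx ⊢
    rwa [← hn' _ (by omega), hn' (n + 1) (by omega)] at hx

/-- An essential left ideal of a semiprime left Noetherian ring contains an element with
zero left annihilator. -/
theorem IsEssentialLeftIdeal.exists_mem_forall_mul_eq_zero {R : Type*} [Ring R]
    [IsNoetherianRing R] (hR : IsSemiprimeRing' R) {I : Ideal R}
    (hI : IsEssentialLeftIdeal I) : ∃ c ∈ I, ∀ x, x * c = 0 → x = 0 := by
  obtain ⟨A, ⟨c, hcI, hc, hA⟩, hmax⟩ := set_has_maximal_iff_noetherian.mpr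
    (inferInstance : IsNoetherian R R)
    {A : Ideal R | ∃ c ∈ I, (∀ x, x * c * c = 0 → x * c = 0) ∧ ∀ x ∈ A, x * c = 0 → x = 0}
    ⟨⊥, 0, I.zero_mem, by simp, by simp⟩
  refine ⟨c, hcI, ?_⟩
  by_contra! hne
  obtain ⟨y, hyc, hy0⟩ := hne
  have hann : leftAnnihilatorIdeal c ≠ ⊥ := fun h =>
    hy0 ((Submodule.mem_bot R).mp (h ▸ mem_leftAnnihilatorIdeal.mpr hyc))
  obtain ⟨b, ⟨hbI, hbc⟩, hb0, hb⟩ := hR.exists_mem_ne_zero_mul_mul_eq_zero (hI _ hann)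
  replace hbc : b * c = 0 := mem_leftAnnihilatorIdeal.mp hbc
  have hsum : ∀ x, x * (c + b) = 0 → x * c = 0 ∧ x * b = 0 := by
    intro x hx
    have hxc : x * c = 0 := hc x (by
      have := congrArg (· * c) hx
      simpa [mul_assoc, add_mul, hbc] using this)
    exact ⟨hxc, by simpa [mul_add, hxc] using hx⟩
  refine hmax (A ⊔ Ideal.span {b}) ⟨c + b, I.add_mem hcI hbI, fun x hx => ?_, ?_⟩ ?_
  · obtain ⟨h1, h2⟩ := hsum _ hx
    have hxc : x * c = 0 := hc x (by simpa [mul_add, add_mul, mul_assoc, hbc] using h1)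
    have hxb : x * b = 0 := hb x (by simpa [mul_add, add_mul, hxc] using h2)
    rw [mul_add, hxc, hxb, add_zero]
  · intro x hx hxcb
    obtain ⟨h1, h2⟩ := hsum _ hxcb
    obtain ⟨u, hu, v, hv, rfl⟩ := Submodule.mem_sup.mp hx
    obtain ⟨r, rfl⟩ := Ideal.mem_span_singleton'.mp hv
    have hu0 : u = 0 := hA u hu (by simpa [add_mul, mul_assoc, hbc] using h1)
    subst hu0
    rw [zero_add] at h2 ⊢
    exact hb r h2
  · refine lt_of_le_not_ge le_sup_left fun h => hb0 (hA b ?_ hbc)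
    exact h (Ideal.mem_sup_right (Ideal.mem_span_singleton_self b))

/-- If the image of an endomorphism of a left Noetherian ring contains a left ideal `R c`
with `c` of zero left annihilator, then the endomorphism is injective: otherwise the strictly
monotone map `X ↦ σ⁻¹(X c)` on left ideals would yield an infinite ascending chain. -/
theorem RingHom.injective_of_forall_mul_mem_range {R : Type*} [Ring R] [IsNoetherianRing R]
    (σ : R →+* R) {c : R} (hc : ∀ x, x * c = 0 → x = 0)
    (hrange : ∀ x, x * c ∈ Set.range σ) : Function.Injective σ := by
  let φ : Ideal R → Ideal R := fun X =>
    Ideal.comap σ (Submodule.map (LinearMap.toSpanSingleton R R c) X)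
  have hφ_mem : ∀ X r, r ∈ φ X ↔ ∃ x ∈ X, x * c = σ r := by
    intro X r
    simp [φ, Ideal.mem_comap, Submodule.mem_map]
  have hφ : StrictMono φ := by
    refine Monotone.strictMono_of_injective (fun X Y h r hr => ?_) fun X Y h => ?_
    · obtain ⟨x, hx, hxr⟩ := (hφ_mem _ _).mp hr
      exact (hφ_mem _ _).mpr ⟨x, h hx, hxr⟩
    · have key : ∀ X Y, φ X = φ Y → X ≤ Y := by
        intro X Y h x hx
        obtain ⟨r, hr⟩ := hrange x
        obtain ⟨y, hy, hyr⟩ := (hφ_mem _ _).mp (h ▸ (hφ_mem X r).mpr ⟨x, hx, hr.symm⟩)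
        have : x - y = 0 := hc _ (by rw [sub_mul, hyr, hr, sub_self])
        rwa [sub_eq_zero.mp this]
      exact le_antisymm (key _ _ h) (key _ _ h.symm)
  rw [injective_iff_map_eq_zero]
  by_contra! hne
  obtain ⟨k, hk, hk0⟩ := hne
  have hlt : (⊥ : Ideal R) < φ ⊥ := bot_lt_iff_ne_bot.mpr fun h =>
    hk0 ((Submodule.mem_bot R).mp (h ▸ (hφ_mem ⊥ k).mpr ⟨0, zero_mem _, by rw [zero_mul, hk]⟩))
  have hchain : StrictMono fun n => φ^[n] ⊥ := hφ.strictMono_iterate_of_lt_map hlt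
  exact not_strictMono_of_wellFoundedGT _ hchain

/-- **Theorem 1.3 (answer to the question of Leroy and Matczuk).** Every endomorphism
with large image of a semiprime left Noetherian ring is a monomorphism. -/
theorem injective_of_large_endomorphism_of_noetherian {R : Type*} [Ring R]
    (hsemiprime : IsSemiprimeRing' R) (hnoeth : IsNoetherianRing R)
    (σ : R →+* R) (hlarge : HasLargeImage σ) :
    Function.Injective σ := by
  obtain ⟨I, hI, hrange⟩ := hlarge
  obtain ⟨c, hcI, hc⟩ := hI.exists_mem_forall_mul_eq_zero hsemiprime
  exact σ.injective_of_forall_mul_mem_range hc fun x => hrange (I.mul_mem_left x hcI)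
end

section
/- Let R be a ring, let S be a left denominator set of R with ass_l(S) = a, let θ : R → S⁻¹R be the canonical map r ↦ r/1, and let T be a multiplicative subset of R such that S ⊆ T and θ(T) consists of units of S⁻¹R. Then T is a left denominator set of R with ass_l(T) = a, and there is an R-ring isomorphism T⁻¹R ≅ S⁻¹R. -/
/-- The subring of left fractions `φ(t)⁻¹ φ(r)`, with `t` in a left Ore set `T`, in the target of a
ring homomorphism `φ`. -/
def leftFractionSubring {R P : Type*} [Ring R] [Ring P] {T : Set R} (hT : IsLeftOreSet T)
    (φ : R →+* P) : Subring P where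
  carrier := {p | ∃ t ∈ T, ∃ r : R, φ t * p = φ r}
  one_mem' := ⟨1, hT.1.1, 1, by simp⟩
  zero_mem' := ⟨1, hT.1.1, 0, by simp⟩
  neg_mem' := by
    rintro p ⟨t, ht, r, h⟩
    exact ⟨t, ht, -r, by simp [h]⟩
  add_mem' := by
    rintro p q ⟨t, ht, r, hp⟩ ⟨s, hs, r', hq⟩
    obtain ⟨u, hu, v, huv⟩ := hT.2 t s hs
    refine ⟨u * t, hT.1.2.2 u hu t ht, u * r + v * r', ?_⟩
    have hq' : φ (u * t) * q = φ (v * r') := by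
      rw [huv, map_mul, mul_assoc, hq, map_mul]
    rw [mul_add, hq', map_mul, mul_assoc, hp, map_add, map_mul φ u r]
  mul_mem' := by
    rintro p q ⟨t, ht, r, hp⟩ ⟨s, hs, r', hq⟩
    obtain ⟨u, hu, v, huv⟩ := hT.2 r s hs
    refine ⟨u * t, hT.1.2.2 u hu t ht, v * r', ?_⟩
    calc φ (u * t) * (p * q) = φ u * (φ t * p) * q := by simp only [map_mul, mul_assoc]
      _ = φ (u * r) * q := by rw [hp, map_mul]
      _ = φ v * (φ s * q) := by rw [huv, map_mul, mul_assoc]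
      _ = φ (v * r') := by rw [hq, map_mul]

theorem map_mem_leftFractionSubring {R P : Type*} [Ring R] [Ring P] {T : Set R}
    (hT : IsLeftOreSet T) (φ : R →+* P) (r : R) : φ r ∈ leftFractionSubring hT φ :=
  ⟨1, hT.1.1, r, by simp⟩

theorem map_eq_zero_of_mem_assL {R P : Type*} [Ring R] [Ring P] {T : Set R} {φ : R →+* P}
    (hφ : ∀ t ∈ T, IsUnit (φ t)) {r : R} (hr : r ∈ assL T) : φ r = 0 := by
  obtain ⟨t, ht, h⟩ := hr
  rw [← (hφ t ht).mul_right_eq_zero, ← map_mul, h, map_zero]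

/-- If `π ∘ φ` is a left localization at `T` and `φ` inverts `T`, then `π` identifies the ring of
left fractions of `φ` with the localization. -/
theorem IsLeftLocalization.bijective_leftFractionSubring {R P Q : Type*} [Ring R] [Ring P] [Ring Q]
    {T : Set R} (hT : IsLeftOreSet T) {φ : R →+* P} (hφ : ∀ t ∈ T, IsUnit (φ t)) {π : P →+* Q}
    (hloc : IsLeftLocalization T (π.comp φ)) :
    Function.Bijective (π.comp (leftFractionSubring hT φ).subtype) := by
  constructor
  · rw [injective_iff_map_eq_zero]
    rintro ⟨p, t, ht, r, h⟩ hp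
    have hp : π p = 0 := hp
    have hr : φ r = 0 := by
      refine map_eq_zero_of_mem_assL hφ ((hloc.ker_eq r).1 ?_)
      rw [RingHom.comp_apply, ← h, map_mul, hp, mul_zero]
    rw [hr, (hφ t ht).mul_right_eq_zero] at h
    exact Subtype.ext h
  · intro q
    obtain ⟨t, ht, r, h⟩ := hloc.exists_rep q
    have hp : φ t * (Ring.inverse (φ t) * φ r) = φ r :=
      Ring.mul_inverse_cancel_left _ _ (hφ t ht)
    refine ⟨⟨_, t, ht, r, hp⟩, (hloc.isUnit t ht).mul_left_cancel ?_⟩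
    exact ((map_mul π _ _).symm.trans (congrArg π hp)).trans h.symm

/-- Any two left localizations at a left Ore set are isomorphic over the base ring. -/
theorem IsLeftLocalization.exists_ringEquiv {R Q Q' : Type*} [Ring R] [Ring Q] [Ring Q']
    {T : Set R} (hT : IsLeftOreSet T) {θ : R →+* Q} {θ' : R →+* Q'}
    (hθ : IsLeftLocalization T θ) (hθ' : IsLeftLocalization T θ') :
    ∃ e : Q' ≃+* Q, ∀ r : R, e (θ' r) = θ r := by
  have hφ : ∀ t ∈ T, IsUnit (θ'.prod θ t) := fun t ht =>
    Prod.isUnit_iff.2 ⟨hθ'.isUnit t ht, hθ.isUnit t ht⟩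
  let e₁ := RingEquiv.ofBijective _
    (bijective_leftFractionSubring hT hφ (π := RingHom.fst Q' Q) hθ')
  let e₂ := RingEquiv.ofBijective _
    (bijective_leftFractionSubring hT hφ (π := RingHom.snd Q' Q) hθ)
  refine ⟨e₁.symm.trans e₂, fun r => ?_⟩
  have h : e₁.symm (θ' r) = ⟨θ'.prod θ r, map_mem_leftFractionSubring hT _ r⟩ :=
    e₁.symm_apply_eq.2 rfl
  rw [RingEquiv.trans_apply, h]
  rfl

/-- **Proposition 2.1.(1).** If `S` is a left denominator set of `R` with `assL S = a`,
`θ : R → S⁻¹R` is the canonical map and `T` is a multiplicative set with `S ⊆ T` whose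
image under `θ` consists of units, then `T` is a left denominator set with `assL T = a`
and `T⁻¹R ≅ S⁻¹R` as `R`-rings. -/
theorem denominator_set_extension {R : Type u} {Q : Type v} [Ring R] [Ring Q]
    (S : Set R) (a : Set R) (hS : IsLeftDenominatorSet S) (ha : assL S = a)
    (θ : R →+* Q) (hloc : IsLeftLocalization S θ)
    (T : Set R) (hT : IsMultSet T) (hST : S ⊆ T) (hTunit : ∀ t ∈ T, IsUnit (θ t)) :
    IsLeftDenominatorSet T ∧ assL T = a ∧
      ∀ (Q' : Type w) [Ring Q'] (θ' : R →+* Q'), IsLeftLocalization T θ' →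
        ∃ e : Q' ≃+* Q, ∀ r : R, e (θ' r) = θ r := by
  have hass : assL T = assL S := by
    ext r
    exact ⟨fun hr => (hloc.ker_eq r).1 (map_eq_zero_of_mem_assL hTunit hr),
      fun ⟨s, hs, h⟩ => ⟨s, hST hs, h⟩⟩
  have hOre : IsLeftOreSet T := by
    refine ⟨hT, fun r t ht => ?_⟩
    obtain ⟨s, hs, r₁, h⟩ := hloc.exists_rep (θ r * Ring.inverse (θ t))
    have hker : θ (s * r - r₁ * t) = 0 := by
      rw [map_sub, map_mul, map_mul, ← h, mul_assoc, mul_assoc,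
        Ring.inverse_mul_cancel _ (hTunit t ht), mul_one, sub_self]
    obtain ⟨s', hs', h'⟩ := (hloc.ker_eq _).1 hker
    refine ⟨s' * s, hST (hS.1.1.2.2 s' hs' s hs), s' * r₁, ?_⟩
    rwa [mul_sub, ← mul_assoc, ← mul_assoc, sub_eq_zero] at h'
  have hlocT : IsLeftLocalization T θ :=
    ⟨hTunit, fun r => hass ▸ hloc.ker_eq r, fun q =>
      let ⟨s, hs, r, h⟩ := hloc.exists_rep q
      ⟨s, hST hs, r, h⟩⟩
  refine ⟨⟨hOre, fun r t ht h => (hlocT.ker_eq r).1 ?_⟩, hass.trans ha,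
    fun Q' _ θ' hθ' => hlocT.exists_ringEquiv hOre hθ'⟩
  rw [← (hTunit t ht).mul_left_eq_zero, ← map_mul, h, map_zero]
end

section
/- Let R be a semiprime left Goldie ring and let σ be a ring endomorphism of R such that σ(C_R) ⊆ C_R, where C_R is the set of regular elements of R. Then the image ring σ(R) is a semiprime left Goldie ring. -/
/-- A sequence of left ideals, each meeting the sum of its successors trivially,
is independent. -/
theorem iSupIndep_of_disjoint_iSup_gt {R : Type*} [Ring R] {N : ℕ → Ideal R}
    (h : ∀ n, Disjoint (N n) (⨆ i > n, N i)) : iSupIndep N := by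
  rw [iSupIndep_iff_finsetSum_eq_zero_imp_eq_zero]
  intro s v hv hsum i
  induction i using Nat.strong_induction_on with
  | _ i ih =>
    intro hi
    refine Submodule.disjoint_def.1 (h i) _ (hv i hi) ?_
    rw [← Finset.add_sum_erase s v hi] at hsum
    rw [eq_neg_of_add_eq_zero_left hsum]
    refine neg_mem (sum_mem fun j hj => ?_)
    obtain ⟨hne, hjs⟩ := Finset.mem_erase.1 hj
    rcases lt_or_gt_of_ne hne with hlt | hgt
    · rw [ih j hlt hjs]
      exact zero_mem _
    · exact (le_iSup₂_of_le (f := fun j (_ : j > i) => N j) j hgt le_rfl) (hv j hjs)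

section Annihilators

variable {R : Type*} [Ring R]

theorem HasFiniteLeftUniformDimension.exists_not_disjoint
    (h : HasFiniteLeftUniformDimension R) (N : ℕ → Ideal R) (hN : ∀ n, N n ≠ ⊥) :
    ∃ n, ¬ Disjoint (N n) (⨆ i > n, N i) := by
  by_contra! hd
  exact h ⟨N, hN, iSupIndep_of_disjoint_iSup_gt hd⟩

theorem ACCLeftAnnihilators.exists_eq (h : ACCLeftAnnihilators R) (a : ℕ → R)
    (ha : ∀ n x, x * a n = 0 → x * a (n + 1) = 0) :
    ∃ N, ∀ n, N ≤ n → ∀ x, x * a n = 0 → x * a N = 0 := by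
  obtain ⟨N, hN⟩ := h (fun n => leftAnnihilator R {a n}) (fun n => ⟨_, rfl⟩)
    (monotone_nat_of_le_succ fun n x hx => by
      simp only [leftAnnihilator, Set.mem_singleton_iff, forall_eq, Set.mem_ofPred_eq] at hx ⊢
      exact ha n x hx)
  refine ⟨N, fun n hn x hx => ?_⟩
  have : x ∈ leftAnnihilator R {a n} := by simpa [leftAnnihilator] using hx
  rw [show leftAnnihilator R {a n} = leftAnnihilator R {a N} from hN n hn] at this
  simpa [leftAnnihilator] using this

theorem ACCLeftAnnihilators.exists_maximal (h : ACCLeftAnnihilators R) {P : R → Prop}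
    (hP : ∃ a, P a) :
    ∃ a, P a ∧ ∀ b, P b → (∀ x, x * a = 0 → x * b = 0) → ∀ x, x * b = 0 → x * a = 0 := by
  by_contra! hc
  choose f hf1 hf2 y hy1 hy2 using hc
  obtain ⟨a₀, h₀⟩ := hP
  let g : ℕ → {a : R // P a} := fun n =>
    Nat.rec ⟨a₀, h₀⟩ (fun _ b => ⟨f b.1 b.2, hf1 b.1 b.2⟩) n
  obtain ⟨N, hN⟩ := h.exists_eq (fun n => (g n).1) fun n x hx => hf2 (g n).1 (g n).2 x hx
  exact hy2 (g N).1 (g N).2 (hN (N + 1) N.le_succ _ (hy1 (g N).1 (g N).2))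

theorem IsSemiprimeRing'.eq_zero_of_forall_mul_mul (h : IsSemiprimeRing' R) {a : R}
    (ha : ∀ r, a * r * a = 0) : a = 0 := by
  have h1 : ∀ x ∈ TwoSidedIdeal.span {a}, ∀ r, a * r * x = 0 := by
    intro x hx
    induction hx using TwoSidedIdeal.span_induction with
    | mem x hx => rw [Set.mem_singleton_iff.1 hx]; exact ha
    | zero => simp
    | add x y _ _ hx hy => intro r; rw [mul_add, hx, hy, add_zero]
    | neg x _ hx => intro r; rw [mul_neg, hx, neg_zero]
    | left_absorb s x _ hx => intro r; rw [← mul_assoc, mul_assoc a]; exact hx _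
    | right_absorb s x _ hx => intro r; rw [← mul_assoc, hx, zero_mul]
  have h2 : ∀ y ∈ TwoSidedIdeal.span {a}, ∀ x ∈ TwoSidedIdeal.span {a}, y * x = 0 := by
    intro y hy
    induction hy using TwoSidedIdeal.span_induction with
    | mem y hy =>
      rw [Set.mem_singleton_iff.1 hy]
      intro x hx
      simpa using h1 x hx 1
    | zero => simp
    | add y z _ _ hy hz => intro x hx; rw [add_mul, hy x hx, hz x hx, add_zero]
    | neg y _ hy => intro x hx; rw [neg_mul, hy x hx, neg_zero]
    | left_absorb s y _ hy => intro x hx; rw [mul_assoc, hy x hx, mul_zero]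
    | right_absorb s y _ hy =>
      intro x hx
      rw [mul_assoc]
      exact hy _ (TwoSidedIdeal.mul_mem_left _ _ _ hx)
  have h3 := h (TwoSidedIdeal.span {a})
    ⟨2, two_pos, fun f hf => by simpa using h2 _ (hf 0) _ (hf 1)⟩
  have h4 : a ∈ TwoSidedIdeal.span {a} := TwoSidedIdeal.subset_span rfl
  rwa [h3] at h4

/-- A semiprime ring with the a.c.c. on left annihilators has no nonzero nil one-sided
principal ideal. -/
theorem IsSemiprimeRing'.eq_zero_of_forall_isNilpotent (h : IsSemiprimeRing' R)
    (hacc : ACCLeftAnnihilators R) {a : R} (ha : ∀ r, IsNilpotent (a * r)) : a = 0 := by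
  by_contra hne
  obtain ⟨b, ⟨hb0, hb⟩, hmax⟩ := hacc.exists_maximal
    (P := fun a => a ≠ 0 ∧ ∀ r, IsNilpotent (a * r)) ⟨a, hne, ha⟩
  refine hb0 (h.eq_zero_of_forall_mul_mul fun r => ?_)
  by_cases hbr : b * r = 0
  · rw [hbr, zero_mul]
  have : Nontrivial R := ⟨_, _, hbr⟩
  obtain ⟨k, hk⟩ : ∃ k, nilpotencyClass (b * r) = k + 2 := by
    refine ⟨nilpotencyClass (b * r) - 2, ?_⟩
    have h0 := pos_nilpotencyClass_iff.2 (hb r)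
    have h1 := mt eq_zero_of_nilpotencyClass_eq_one hbr
    omega
  obtain ⟨h0, h1⟩ := nilpotencyClass_eq_succ_iff.1 hk
  rw [pow_succ', mul_assoc] at h1
  refine hmax _ ⟨h1, fun s => ?_⟩ (fun x hx => ?_) (b * r) ?_
  · rw [mul_assoc]
    exact hb _
  · rw [← mul_assoc, hx, zero_mul]
  · rw [← mul_assoc b, ← pow_succ', ← pow_succ', h0]

/-- In a semiprime ring with the a.c.c. on left annihilators, every nonzero left ideal
contains a nonzero element `a` such that `a` and `a * a` have the same left annihilator. -/
theorem IsSemiprimeRing'.exists_mem_forall_mul_mul (h : IsSemiprimeRing' R)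
    (hacc : ACCLeftAnnihilators R) {J : Ideal R} (hJ : J ≠ ⊥) :
    ∃ a ∈ J, a ≠ 0 ∧ ∀ x, x * a * a = 0 → x * a = 0 := by
  obtain ⟨b, hb, hb0⟩ := Submodule.exists_mem_ne_zero_of_ne_bot hJ
  obtain ⟨r, hr⟩ : ∃ r, ¬ IsNilpotent (r * b) := by
    by_contra! hnil
    refine hb0 (h.eq_zero_of_forall_isNilpotent hacc fun r => ?_)
    obtain ⟨n, hn⟩ := hnil r
    refine ⟨n + 1, ?_⟩
    have hcomm : SemiconjBy b (r * b) (b * r) := (mul_assoc b r b).symm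
    rw [pow_succ, ← mul_assoc, ← (hcomm.pow_right n).eq, hn, mul_zero, zero_mul]
  obtain ⟨N, hN⟩ := hacc.exists_eq (fun n => (r * b) ^ n) fun n x hx => by
    rw [pow_succ, ← mul_assoc, hx, zero_mul]
  refine ⟨(r * b) ^ (N + 1), ?_, fun h0 => hr ⟨_, h0⟩, fun x hx => ?_⟩
  · rw [pow_succ]
    exact J.mul_mem_left _ (J.mul_mem_left _ hb)
  · rw [mul_assoc, ← pow_add] at hx
    rw [pow_succ, ← mul_assoc, hN (N + 1 + (N + 1)) (by omega) x hx, zero_mul]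

/-- In a semiprime ring with the a.c.c. on left annihilators, the left singular ideal
vanishes. -/
theorem IsSemiprimeRing'.eq_zero_of_essential (h : IsSemiprimeRing' R)
    (hacc : ACCLeftAnnihilators R) {I : Ideal R} (hI : IsEssentialLeftIdeal I) {z : R}
    (hz : ∀ x ∈ I, x * z = 0) : z = 0 := by
  refine h.eq_zero_of_forall_isNilpotent hacc fun r => ?_
  have hzr : ∀ x ∈ I, x * (z * r) = 0 := fun x hx => by rw [← mul_assoc, hz x hx, zero_mul]
  generalize z * r = w at hzr
  obtain ⟨N, hN⟩ := hacc.exists_eq (fun n => w ^ n) fun n x hx => by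
    rw [pow_succ, ← mul_assoc, hx, zero_mul]
  refine ⟨N, ?_⟩
  by_contra hne
  refine hI (Ideal.span {w ^ N}) (by simpa using hne) (eq_bot_iff.2 fun y hy => ?_)
  obtain ⟨hyI, hy⟩ := hy
  obtain ⟨x, rfl⟩ := Ideal.mem_span_singleton'.1 hy
  refine hN (N + 1) N.le_succ x ?_
  rw [pow_succ, ← mul_assoc]
  exact hzr _ hyI

/-- In a ring of finite left uniform dimension, the left ideal generated by an element
with zero left annihilator is essential. -/
theorem HasFiniteLeftUniformDimension.isEssentialLeftIdeal_span
    (h : HasFiniteLeftUniformDimension R) {c : R} (hc : ∀ x, x * c = 0 → x = 0) :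
    IsEssentialLeftIdeal (Ideal.span {c}) := by
  intro J hJ hbot
  have hpow : ∀ (n : ℕ) x, x * c ^ n = 0 → x = 0 := by
    intro n
    induction n with
    | zero => simp
    | succ n ih =>
      intro x hx
      rw [pow_succ, ← mul_assoc] at hx
      exact ih x (hc _ hx)
  let φ : ℕ → R →ₗ[R] R := fun n => LinearMap.toSpanSingleton R R (c ^ n)
  obtain ⟨n, hn⟩ := h.exists_not_disjoint (fun n => Submodule.map (φ n) J) fun n h0 => by
    obtain ⟨b, hb, hb0⟩ := Submodule.exists_mem_ne_zero_of_ne_bot hJ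
    refine hb0 (hpow n b ?_)
    have : φ n b ∈ Submodule.map (φ n) J := Submodule.mem_map_of_mem hb
    rw [h0] at this
    simpa [φ] using this
  refine hn (Submodule.disjoint_def.2 fun x hx hx' => ?_)
  obtain ⟨j, hj, rfl⟩ := hx
  have hle : ⨆ i > n, Submodule.map (φ i) J ≤ Ideal.span {c ^ (n + 1)} := by
    refine iSup₂_le fun i hi => ?_
    rintro _ ⟨y, -, rfl⟩
    obtain ⟨m, rfl⟩ := Nat.exists_eq_add_of_lt hi
    refine Ideal.mem_span_singleton'.2 ⟨y * c ^ m, ?_⟩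
    simp only [φ, LinearMap.toSpanSingleton_apply, smul_eq_mul, mul_assoc, ← pow_add]
    congr 2
    omega
  obtain ⟨y, hy⟩ := Ideal.mem_span_singleton'.1 (hle hx')
  have hjy : y * c = j := by
    refine sub_eq_zero.1 (hpow n _ ?_)
    rw [sub_mul, mul_assoc, ← pow_succ', hy]
    simp [φ]
  have : j ∈ Ideal.span {c} ⊓ J := ⟨Ideal.mem_span_singleton'.2 ⟨y, hjy⟩, hj⟩
  rw [hbot] at this
  rw [(Submodule.mem_bot R).1 this, map_zero]

/-- In a semiprime left Goldie ring, every essential left ideal contains a regular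
element. -/
theorem IsEssentialLeftIdeal.exists_isRegular (h : IsSemiprimeRing' R)
    (hG : IsLeftGoldieRing R) {I : Ideal R} (hI : IsEssentialLeftIdeal I) :
    ∃ c ∈ I, IsRegular c := by
  obtain ⟨hu, hacc⟩ := hG
  suffices ∃ c ∈ I, ∀ x, x * c = 0 → x = 0 by
    obtain ⟨c, hcI, hc⟩ := this
    refine ⟨c, hcI, isRegular_iff.2 ⟨isLeftRegular_iff_right_eq_zero_of_mul.2 fun x hx => ?_,
      isRightRegular_iff_left_eq_zero_of_mul.2 hc⟩⟩
    refine h.eq_zero_of_essential hacc (hu.isEssentialLeftIdeal_span hc) fun y hy => ?_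
    obtain ⟨r, rfl⟩ := Ideal.mem_span_singleton'.1 hy
    rw [mul_assoc, hx, mul_zero]
  by_contra! hno
  have hstep : ∀ c : {c : R // c ∈ I ∧ ∀ x, x * c * c = 0 → x * c = 0},
      ∃ a : R, (a ∈ I ∧ a * c.1 = 0) ∧ a ≠ 0 ∧ ∀ x, x * a * a = 0 → x * a = 0 := by
    rintro ⟨c, hcI, -⟩
    obtain ⟨x, hx, hx0⟩ := hno c hcI
    have hne : Ideal.torsionOf R R c ≠ ⊥ := fun h0 => hx0 <| by
      have : x ∈ Ideal.torsionOf R R c := hx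
      simpa [h0] using this
    obtain ⟨a, ha, ha'⟩ := h.exists_mem_forall_mul_mul hacc (hI _ hne)
    exact ⟨a, ha, ha'⟩
  choose a ha ha0 haa using hstep
  have hadd : ∀ c x, x * (c.1 + a c) = 0 → x * c.1 = 0 ∧ x * a c = 0 := by
    intro c x hx
    have hc : x * c.1 = 0 := c.2.2 x <| by
      have := congrArg (· * c.1) hx
      simpa [mul_add, add_mul, mul_assoc, (ha c).2] using this
    exact ⟨hc, by simpa [mul_add, hc] using hx⟩
  let g : ℕ → {c : R // c ∈ I ∧ ∀ x, x * c * c = 0 → x * c = 0} := fun n =>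
    Nat.rec ⟨0, I.zero_mem, by simp⟩ (fun _ c => ⟨c.1 + a c, I.add_mem c.2.1 (ha c).1, by
      intro x hx
      obtain ⟨h1, h2⟩ := hadd c _ hx
      have hc : x * c.1 = 0 := c.2.2 x <| by
        simpa [mul_add, add_mul, mul_assoc, (ha c).2] using h1
      have hac : x * a c = 0 := haa c x <| by simpa [mul_add, hc] using h2
      rw [mul_add, hc, hac, add_zero]⟩) n
  have hg : ∀ n x, x * (g (n + 1)).1 = 0 → x * (g n).1 = 0 ∧ x * a (g n) = 0 :=
    fun n x hx => hadd (g n) x hx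
  have hlt : ∀ n i, n < i → a (g i) * a (g n) = 0 := by
    intro n i hi
    have : ∀ x, x * (g i).1 = 0 → x * (g (n + 1)).1 = 0 := by
      induction i, hi using Nat.le_induction with
      | base => exact fun _ => id
      | succ i _ ih => exact fun x hx => ih x (hg i x hx).1
    exact (hg n _ (this _ (ha (g i)).2)).2
  obtain ⟨n, hn⟩ := hu.exists_not_disjoint (fun n => Ideal.span {a (g n)}) fun n h0 =>
    ha0 (g n) (by simpa using h0)
  refine hn (Submodule.disjoint_def.2 fun x hx hx' => ?_)
  have hle : ⨆ i > n, Ideal.span {a (g i)} ≤ Ideal.torsionOf R R (a (g n)) :=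
    iSup₂_le fun i hi => (Ideal.span_singleton_le_iff_mem _).2 (hlt n i hi)
  obtain ⟨y, rfl⟩ := Ideal.mem_span_singleton'.1 hx
  exact haa (g n) y (hle hx')

end Annihilators

section Endomorphism

variable {R : Type*} [Ring R]

/-- In a semiprime ring, the left and right annihilators of a two-sided ideal coincide. -/
theorem IsSemiprimeRing'.forall_mul_eq_zero_iff (h : IsSemiprimeRing' R)
    (K : TwoSidedIdeal R) (x : R) : (∀ k ∈ K, x * k = 0) ↔ ∀ k ∈ K, k * x = 0 := by
  refine ⟨fun hx k hk => h.eq_zero_of_forall_mul_mul fun r => ?_,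
    fun hx k hk => h.eq_zero_of_forall_mul_mul fun r => ?_⟩
  · rw [← mul_assoc, mul_assoc (k * x), mul_assoc k, hx _ (K.mul_mem_left _ _ hk), mul_zero,
      zero_mul]
  · rw [mul_assoc x k r, mul_assoc, ← mul_assoc (k * r), hx _ (K.mul_mem_right _ _ hk),
      zero_mul, mul_zero]

/-- The annihilator of a two-sided ideal, as a two-sided ideal. -/
def TwoSidedIdeal.leftAnn (K : TwoSidedIdeal R) : TwoSidedIdeal R :=
  .mk' {x | ∀ k ∈ K, x * k = 0} (by simp)
    (fun hx hy k hk => by rw [add_mul, hx k hk, hy k hk, add_zero])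
    (fun hx k hk => by rw [neg_mul, hx k hk, neg_zero])
    (fun hy k hk => by rw [mul_assoc, hy k hk, mul_zero])
    (fun hx k hk => by rw [mul_assoc]; exact hx _ (K.mul_mem_left _ _ hk))

theorem TwoSidedIdeal.mem_leftAnn {K : TwoSidedIdeal R} {x : R} :
    x ∈ K.leftAnn ↔ ∀ k ∈ K, x * k = 0 :=
  TwoSidedIdeal.mem_mk' _ _ _ _ _ _ x

theorem IsSemiprimeRing'.isEssentialLeftIdeal_sup_leftAnn (h : IsSemiprimeRing' R)
    (K : TwoSidedIdeal R) : IsEssentialLeftIdeal (K.asIdeal ⊔ K.leftAnn.asIdeal) := by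
  intro J hJ hbot
  obtain ⟨b, hb, hb0⟩ := Submodule.exists_mem_ne_zero_of_ne_bot hJ
  have hzero : ∀ x ∈ K.asIdeal ⊔ K.leftAnn.asIdeal, x ∈ J → x = 0 := fun x hx hxJ => by
    have : x ∈ (K.asIdeal ⊔ K.leftAnn.asIdeal) ⊓ J := ⟨hx, hxJ⟩
    rwa [hbot] at this
  refine hb0 (hzero b (Submodule.mem_sup_right ?_) hb)
  rw [TwoSidedIdeal.mem_asIdeal, TwoSidedIdeal.mem_leftAnn, h.forall_mul_eq_zero_iff]
  exact fun k hk => hzero _ (Submodule.mem_sup_left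
    (TwoSidedIdeal.mem_asIdeal.2 (K.mul_mem_right _ _ hk))) (J.mul_mem_left _ hb)

/-- If an endomorphism `σ` of a semiprime left Goldie ring preserves regular elements, then
its kernel is the annihilator of a two-sided ideal `L`. -/
theorem exists_twoSidedIdeal_ker_eq_annihilator (h : IsSemiprimeRing' R)
    (hG : IsLeftGoldieRing R) (σ : R →+* R) (hreg : ∀ c : R, IsRegular c → IsRegular (σ c)) :
    ∃ L : TwoSidedIdeal R, ∀ x, σ x = 0 ↔ ∀ l ∈ L, x * l = 0 := by
  refine ⟨(TwoSidedIdeal.ker σ).leftAnn, fun x => ⟨fun hx l hl => ?_, fun hx => ?_⟩⟩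
  · exact (h.forall_mul_eq_zero_iff _ l).1 (TwoSidedIdeal.mem_leftAnn.1 hl) x
      ((TwoSidedIdeal.mem_ker σ).2 hx)
  · obtain ⟨c, hc, hcreg⟩ :=
      (h.isEssentialLeftIdeal_sup_leftAnn (TwoSidedIdeal.ker σ)).exists_isRegular h hG
    obtain ⟨k, hk, l, hl, rfl⟩ := Submodule.mem_sup.1 hc
    refine isRightRegular_iff_left_eq_zero_of_mul.1 (hreg _ hcreg).right _ ?_
    rw [map_add, (TwoSidedIdeal.mem_ker σ).1 (TwoSidedIdeal.mem_asIdeal.1 hk), zero_add,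
      ← map_mul, hx l (TwoSidedIdeal.mem_asIdeal.1 hl), map_zero]

end Endomorphism

/-- **Theorem 2.2.(1).** If `R` is a semiprime left Goldie ring and `σ` is a ring
endomorphism of `R` with `σ(C_R) ⊆ C_R`, then the image ring `σ(R)` is a semiprime left
Goldie ring. -/
theorem image_is_semiprime_left_goldie {R : Type*} [Ring R]
    (hsemiprime : IsSemiprimeRing' R) (hgoldie : IsLeftGoldieRing R)
    (σ : R →+* R) (hreg : ∀ c : R, IsRegular c → IsRegular (σ c)) :
    IsSemiprimeRing' σ.range ∧ IsLeftGoldieRing σ.range := by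
  obtain ⟨L, hL⟩ := exists_twoSidedIdeal_ker_eq_annihilator hsemiprime hgoldie σ hreg
  have hL' : ∀ x, σ x = 0 ↔ ∀ l ∈ L, l * x = 0 := fun x =>
    (hL x).trans (hsemiprime.forall_mul_eq_zero_iff L x)
  have hinf : ∀ x ∈ L, σ x = 0 → x = 0 := fun x hx h0 =>
    hsemiprime.eq_zero_of_forall_mul_mul fun r =>
      mul_assoc x r x ▸ (hL x).1 h0 _ (L.mul_mem_left _ _ hx)
  have hker : ∀ x, σ.rangeRestrict x = 0 ↔ σ x = 0 := fun x => by
    rw [Subtype.ext_iff]; simp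
  refine ⟨?_, ?_, ?_⟩
  · rintro J ⟨n, hn, hJ⟩
    refine eq_bot_iff.2 fun y hy => ?_
    obtain ⟨x, rfl⟩ := σ.rangeRestrict_surjective y
    rw [TwoSidedIdeal.mem_bot, hker, hL']
    intro l hl
    have hI := hsemiprime (J.comap σ.rangeRestrict ⊓ L) ⟨n, hn, fun f hf => ?_⟩
    · have : l * x ∈ J.comap σ.rangeRestrict ⊓ L := by
        refine (TwoSidedIdeal.mem_inf _).2 ⟨(TwoSidedIdeal.mem_comap _).2 ?_, L.mul_mem_right _ _ hl⟩
        rw [map_mul]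
        exact J.mul_mem_left _ _ hy
      rwa [hI] at this
    · refine hinf _ ?_ ?_
      · obtain ⟨m, rfl⟩ := Nat.exists_eq_succ_of_ne_zero hn.ne'
        rw [List.ofFn_succ, List.prod_cons]
        exact L.mul_mem_right _ _ ((TwoSidedIdeal.mem_inf _).1 (hf 0)).2
      · rw [← hker, map_list_prod, List.map_ofFn]
        exact hJ _ fun i => (TwoSidedIdeal.mem_comap _).1 ((TwoSidedIdeal.mem_inf _).1 (hf i)).1
  · rintro ⟨f, hf, hind⟩
    refine hgoldie.1 ⟨fun n => (f n).comap σ.rangeRestrict ⊓ L.asIdeal, fun n hn => ?_,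
      fun n => Submodule.disjoint_def.2 fun x hx hx' => ?_⟩
    · refine hf n (eq_bot_iff.2 fun y hy => ?_)
      obtain ⟨x, rfl⟩ := σ.rangeRestrict_surjective y
      rw [Submodule.mem_bot, hker, hL']
      intro l hl
      have : l * x ∈ (f n).comap σ.rangeRestrict ⊓ L.asIdeal :=
        ⟨Ideal.mul_mem_left _ _ hy, TwoSidedIdeal.mem_asIdeal.2 (L.mul_mem_right _ _ hl)⟩
      rwa [show (f n).comap σ.rangeRestrict ⊓ L.asIdeal = ⊥ from hn] at this
    · refine hinf x (TwoSidedIdeal.mem_asIdeal.1 hx.2) ((hker x).1 ?_)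
      have hle : ⨆ j, ⨆ (_ : j ≠ n), (f j).comap σ.rangeRestrict ⊓ L.asIdeal ≤
          (⨆ j, ⨆ (_ : j ≠ n), f j).comap σ.rangeRestrict :=
        iSup₂_le fun j hj => inf_le_left.trans
          (Ideal.comap_mono (le_iSup₂_of_le (f := fun j (_ : j ≠ n) => f j) j hj le_rfl))
      exact Submodule.disjoint_def.1 (hind n) _ hx.1 (hle hx')
  · intro f hf hmono
    choose S hS using hf
    have hpre : ∀ n, σ.rangeRestrict ⁻¹' f n =
        leftAnnihilator R {t | ∃ s, σ.rangeRestrict s ∈ S n ∧ ∃ l ∈ L, t = s * l} := by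
      intro n
      ext x
      simp only [hS n, leftAnnihilator, Set.mem_preimage, Set.mem_ofPred_eq]
      constructor
      · rintro h _ ⟨s, hs, l, hl, rfl⟩
        rw [← mul_assoc]
        refine (hL _).1 ((hker _).1 ?_) l hl
        rw [map_mul, h _ hs]
      · intro h t ht
        obtain ⟨s, rfl⟩ := σ.rangeRestrict_surjective t
        rw [← map_mul, hker, hL]
        intro l hl
        rw [mul_assoc]
        exact h _ ⟨s, ht, l, hl, rfl⟩
    obtain ⟨N, hN⟩ := hgoldie.2 (fun n => σ.rangeRestrict ⁻¹' f n)
      (fun n => ⟨_, hpre n⟩)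
      (fun m n hmn => Set.preimage_mono (hmono hmn))
    exact ⟨N, fun n hn => σ.rangeRestrict_surjective.preimage_injective (hN n hn)⟩
end
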